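/- Let G be a finite group and let χ, η be irreducible complex characters of G. Then χ and η are chain-equivalent (i.e., there exist irreducible characters ψ_1, …, ψ_n of G such that both χ and η occur as constituents of the pointwise product ψ_1 · ψ_2 ⋯ ψ_n) if and only if χ and η have the same central character, i.e., χ(z)·η(1) = η(z)·χ(1) for every z in the center Z(G). (This is the key step in Müger's theorem that the chain group 𝓒(G) is isomorphic to the dual of the center Z(G).) -/

import Mathlib

open CategoryTheory Finset

/-- The inner product of class functions on a finite group:
`⟨φ, η⟩ = (1/|G|) ∑ g, φ g * conj (η g)`, giving the multiplicity of an irreducible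
character `η` in `φ`. -/
noncomputable def charMult (G : Type) [Group G] [Fintype G] (φ η : G → ℂ) : ℂ :=
  (Fintype.card G : ℂ)⁻¹ * ∑ g : G, φ g * (starRingEnd ℂ) (η g)

/-- `χ` is an irreducible complex character of `G`: the character of some irreducible
finite-dimensional complex representation of `G`. -/
def IsIrrChar (G : Type) [Group G] (χ : G → ℂ) : Prop :=
  ∃ V : FDRep ℂ G, Simple V ∧ χ = V.character

/-- Two irreducible characters `χ` and `η` of `G` are chain-equivalent: there is a
chain `ψ 0, …, ψ n` of irreducible characters such that both `χ` and `η` occur as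
constituents of the pointwise product `ψ 0 ⋯ ψ n`. -/
def ChainEquiv (G : Type) [Group G] [Fintype G] (χ η : G → ℂ) : Prop :=
  ∃ (n : ℕ) (ψ : Fin (n + 1) → G → ℂ), (∀ i, IsIrrChar G (ψ i)) ∧
    charMult G (fun g => ∏ i, ψ i g) χ ≠ 0 ∧
    charMult G (fun g => ∏ i, ψ i g) η ≠ 0

/-- Unit complex numbers attaining equality in the triangle inequality are all equal. -/
theorem Multiset.exists_forall_eq_of_card_le_norm_sum {s : Multiset ℂ} (hs : ∀ x ∈ s, ‖x‖ = 1)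
    (h : s.card ≤ ‖s.sum‖) : ∃ c, ∀ x ∈ s, x = c := by
  induction s using Multiset.induction_on with
  | empty => exact ⟨0, by simp⟩
  | cons a s ih =>
    have hle : ‖s.sum‖ ≤ s.card := by
      refine (norm_multiset_sum_le _).trans_eq ?_
      rw [Multiset.map_congr rfl fun x hx => hs x (Multiset.mem_cons_of_mem hx)]
      simp
    have ha := hs a (Multiset.mem_cons_self a s)
    have hadd := norm_add_le a s.sum
    rw [Multiset.sum_cons, Multiset.card_cons] at h
    push_cast at h
    have hsn : ‖s.sum‖ = s.card := by linarith
    obtain ⟨c, hc⟩ := ih (fun x hx => hs x (Multiset.mem_cons_of_mem hx)) hsn.ge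
    have hsum : s.sum = s.card • c := by
      rw [Multiset.eq_replicate.2 ⟨rfl, hc⟩]; simp
    have hray : SameRay ℝ a s.sum := sameRay_iff_norm_add.2 (by linarith)
    refine ⟨a, fun x hx => ?_⟩
    obtain rfl | hx := Multiset.mem_cons.1 hx
    · rfl
    have hxc := hs x (Multiset.mem_cons_of_mem hx)
    rw [hc x hx] at hxc ⊢
    have hpos : 0 < s.card := Multiset.card_pos.2 (by rintro rfl; simp at hx)
    rw [sameRay_iff_norm_smul_eq, hsum, ha, one_smul] at hray
    have hc0 : (s.card : ℂ) ≠ 0 := Nat.cast_ne_zero.2 hpos.ne'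
    rw [nsmul_eq_mul, norm_mul, hxc, Complex.norm_natCast, mul_one, Complex.real_smul,
      Complex.ofReal_natCast] at hray
    exact mul_left_cancel₀ hc0 hray

section Trace

open Module Polynomial

variable {V : Type*} [AddCommGroup V] [Module ℂ V] [FiniteDimensional ℂ V]

theorem norm_eq_one_of_mem_roots_charpoly {f : End ℂ V} {n : ℕ} (hn : n ≠ 0) (hf : f ^ n = 1)
    {x : ℂ} (hx : x ∈ f.charpoly.roots) : ‖x‖ = 1 := by
  have h := ((End.hasEigenvalue_iff_isRoot_charpoly f x).2 (isRoot_of_mem_roots hx)).pow n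
  obtain ⟨v, hv⟩ := h.exists_hasEigenvector
  have h1 := hv.apply_eq_smul
  rw [hf, End.one_apply] at h1
  refine Complex.norm_eq_one_of_pow_eq_one ?_ hn
  exact smul_left_injective ℂ hv.2 (by simpa using h1.symm)

theorem card_roots_charpoly (f : End ℂ V) : f.charpoly.roots.card = finrank ℂ V := by
  rw [← (IsAlgClosed.splits f.charpoly).natDegree_eq_card_roots, f.charpoly_natDegree]

theorem norm_trace_le_finrank {f : End ℂ V} {n : ℕ} (hn : n ≠ 0) (hf : f ^ n = 1) :
    ‖LinearMap.trace ℂ V f‖ ≤ finrank ℂ V := by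
  rw [End.trace_eq_sum_roots_charpoly_of_splits (IsAlgClosed.splits _)]
  refine (norm_multiset_sum_le _).trans_eq ?_
  rw [Multiset.map_congr rfl fun x hx => norm_eq_one_of_mem_roots_charpoly hn hf hx]
  simp [card_roots_charpoly]

/-- An endomorphism of finite order whose trace has maximal norm is scalar. -/
theorem eq_smul_id_of_finrank_le_norm_trace {f : End ℂ V} {n : ℕ} (hn : n ≠ 0) (hf : f ^ n = 1)
    (h : finrank ℂ V ≤ ‖LinearMap.trace ℂ V f‖) : ∃ c : ℂ, f = c • LinearMap.id := by
  rw [End.trace_eq_sum_roots_charpoly_of_splits (IsAlgClosed.splits _),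
    ← card_roots_charpoly f] at h
  obtain ⟨c, hc⟩ := Multiset.exists_forall_eq_of_card_le_norm_sum
    (fun x hx => norm_eq_one_of_mem_roots_charpoly hn hf hx) h
  refine ⟨c, ?_⟩
  have hp := (IsAlgClosed.splits f.charpoly).eq_prod_roots_of_monic f.charpoly_monic
  rw [Multiset.eq_replicate.2 ⟨rfl, hc⟩, Multiset.map_replicate, Multiset.prod_replicate] at hp
  have hnil : IsNilpotent (f - algebraMap ℂ (End ℂ V) c) := by
    refine ⟨f.charpoly.roots.card, ?_⟩
    have := f.aeval_self_charpoly
    rw [hp] at this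
    simpa using this
  have hss : f.IsSemisimple := by
    refine End.isSemisimple_of_squarefree_aeval_eq_zero (p := X ^ n - C 1)
      (separable_X_pow_sub_C 1 (Nat.cast_ne_zero.2 hn) one_ne_zero).squarefree ?_
    simp [hf]
  have := End.eq_zero_of_isNilpotent_isSemisimple hnil (End.isSemisimple_sub_algebraMap_iff.2 hss)
  rw [sub_eq_zero] at this
  rw [this]
  rfl

end Trace

section MonoidAlgebra

open MonoidAlgebra

theorem MonoidAlgebra.exists_isMaximal_notMem {G : Type} [Group G] [Finite G]
    {x : MonoidAlgebra ℂ G} (hx : x ≠ 0) :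
    ∃ m : Ideal (MonoidAlgebra ℂ G), m.IsMaximal ∧ x ∉ m := by
  have h := IsSemisimpleRing.jacobson_eq_bot (MonoidAlgebra ℂ G)
  rw [Ring.jacobson_eq_sInf_isMaximal] at h
  by_contra! hm
  apply hx
  rw [← Ideal.mem_bot, ← h, Ideal.mem_sInf]
  exact fun {m} => hm m

theorem isIrrChar_of_isIrreducible {G : Type} [Group G] [Fintype G] {V : Type}
    [AddCommGroup V] [Module ℂ V] [FiniteDimensional ℂ V] (ρ : Representation ℂ G V) [ρ.IsIrreducible] :
    IsIrrChar G ρ.character := by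
  refine ⟨FDRep.of ρ, ?_, rfl⟩
  have := invertibleOfNonzero (NeZero.ne (Nat.card G : ℂ))
  rw [FDRep.simple_iff_char_is_norm_one]
  have h := Representation.char_orthonormal ρ ρ
  rw [if_pos ⟨.refl ρ⟩, inv_mul_eq_one₀ (NeZero.ne _)] at h
  exact h.symm

theorem Representation.isIrreducible_ofModule' {k G M : Type*} [Field k] [Monoid G]
    [AddCommGroup M] [Module k M] [Module (MonoidAlgebra k G) M]
    [IsScalarTower k (MonoidAlgebra k G) M] [IsSimpleModule (MonoidAlgebra k G) M] :
    (Representation.ofModule' M : Representation k G M).IsIrreducible := by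
  have hM : Nontrivial M := IsSimpleModule.nontrivial (MonoidAlgebra k G) M
  refine { exists_pair_ne := ⟨⊥, ⊤, fun h => ?_⟩, eq_bot_or_eq_top := fun σ => ?_ }
  · exact bot_ne_top (congrArg Subrepresentation.toSubmodule h)
  · let N : Submodule (MonoidAlgebra k G) M :=
      { σ.toSubmodule with
        smul_mem' := fun r x hx => by
          induction r using MonoidAlgebra.induction_on with
          | of g => exact σ.apply_mem_toSubmodule g hx
          | add a b ha hb => rw [add_smul]; exact σ.toSubmodule.add_mem ha hb
          | smul c a ha => rw [smul_assoc]; exact σ.toSubmodule.smul_mem c ha }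
    refine (eq_bot_or_eq_top N).imp (fun h => ?_) fun h => ?_ <;>
    · refine SetLike.ext fun x => ?_
      exact (SetLike.ext_iff.1 h x)

/-- A noncentral element acts by a non-scalar in some irreducible representation. -/
theorem exists_isIrreducible_ne_smul_id {G : Type} [Group G] [Fintype G] {g : G}
    (hg : g ∉ Subgroup.center G) :
    ∃ (V : Type) (_ : AddCommGroup V) (_ : Module ℂ V) (_ : FiniteDimensional ℂ V)
      (ρ : Representation ℂ G V), ρ.IsIrreducible ∧ ∀ c : ℂ, ρ g ≠ c • LinearMap.id := by
  rw [Subgroup.mem_center_iff] at hg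
  push Not at hg
  obtain ⟨h, hgh⟩ := hg
  obtain ⟨m, hm, hx⟩ := MonoidAlgebra.exists_isMaximal_notMem (G := G)
    (x := of ℂ G (h * g) - of ℂ G (g * h)) (sub_ne_zero.2 fun H => hgh (of_injective H))
  have hs : IsSimpleModule (MonoidAlgebra ℂ G) (MonoidAlgebra ℂ G ⧸ m) :=
    isSimpleModule_iff_isCoatom.2 hm.out
  have : FiniteDimensional ℂ (MonoidAlgebra ℂ G ⧸ m) :=
    Module.Finite.of_surjective (m.mkQ.restrictScalars ℂ) m.mkQ_surjective
  refine ⟨MonoidAlgebra ℂ G ⧸ m, inferInstance, inferInstance, this,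
    Representation.ofModule' _, Representation.isIrreducible_ofModule', fun c hc => hx ?_⟩
  have key (k : G) : m.mkQ (of ℂ G g * of ℂ G k) = c • m.mkQ (of ℂ G k) :=
    congr($hc (m.mkQ (of ℂ G k)))
  have h1 := congr(of ℂ G h • $(key 1))
  rw [← Submodule.Quotient.mk_eq_zero, ← Submodule.mkQ_apply, map_sub, sub_eq_zero,
    (of ℂ G).map_mul, (of ℂ G).map_mul, key h]
  rw [← m.mkQ.map_smul, smul_comm, ← m.mkQ.map_smul] at h1
  simpa only [smul_eq_mul, map_one, mul_one] using h1

end MonoidAlgebra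

theorem exists_prod_eq_mul_of_mem_closure {G : Type} [Group G] {χ p : G → ℂ} (hχ : IsIrrChar G χ)
    (hp : p ∈ Submonoid.closure {ψ | IsIrrChar G ψ}) :
    ∃ (n : ℕ) (ψ : Fin (n + 1) → G → ℂ), (∀ i, IsIrrChar G (ψ i)) ∧
      ∀ g, ∏ i, ψ i g = χ g * p g := by
  obtain ⟨l, hl, rfl⟩ := Submonoid.exists_list_of_mem_closure hp
  refine ⟨l.length, (χ :: l).get, fun i => ?_, fun g => ?_⟩
  · obtain h | h := List.mem_cons.1 ((χ :: l).get_mem i)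
    · rw [h]; exact hχ
    · exact hl _ h
  · rw [← Finset.prod_apply, ← List.prod_ofFn, List.ofFn_get, List.prod_cons, Pi.mul_apply]

theorem tendsto_sum_mul_pow {G : Type} [Fintype G] (f φ : G → ℂ) (h : ∀ g, f g = 1 ∨ ‖f g‖ < 1) :
    Filter.Tendsto (fun n : ℕ => ∑ g, φ g * f g ^ n) Filter.atTop
    (nhds (∑ g, φ g * (if f g = 1 then 1 else 0))) := by
  refine tendsto_finsetSum _ fun g _ => Filter.Tendsto.const_mul _ ?_
  split_ifs with h1
  · exact tendsto_const_nhds.congr fun n => by rw [h1, one_pow]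
  · exact tendsto_pow_atTop_nhds_zero_of_norm_lt_one ((h g).resolve_left h1)

namespace IsIrrChar

variable {G : Type} [Group G] [Fintype G] {χ : G → ℂ}

theorem norm_le (hχ : IsIrrChar G χ) (g : G) : ‖χ g‖ ≤ ‖χ 1‖ := by
  obtain ⟨V, -, rfl⟩ := hχ
  rw [FDRep.char_one, Complex.norm_natCast]
  exact norm_trace_le_finrank Fintype.card_ne_zero (by rw [← map_pow, pow_card_eq_one, map_one])

theorem one_ne_zero (hχ : IsIrrChar G χ) : χ 1 ≠ 0 := by
  intro h
  have h0 (g : G) : χ g = 0 := by simpa [h] using hχ.norm_le g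
  obtain ⟨V, hV, rfl⟩ := hχ
  rw [FDRep.simple_iff_char_is_norm_one] at hV
  simp [h0, eq_comm (a := (0 : ℂ))] at hV

theorem exists_mul_eq (hχ : IsIrrChar G χ) {z : G} (hz : z ∈ Subgroup.center G) :
    ∃ c : ℂ, c ^ Fintype.card G = 1 ∧ ∀ g, χ (z * g) = c * χ g := by
  have h1 := hχ.one_ne_zero
  obtain ⟨V, hV, rfl⟩ := hχ
  let f : V ⟶ V :=
    { hom := Action.ρ V z
      comm := fun g => by
        rw [← End.mul_def, ← End.mul_def, ← map_mul, ← map_mul, Subgroup.mem_center_iff.1 hz] }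
  obtain ⟨c, hc⟩ := endomorphism_simple_eq_smul_id ℂ f
  have hρ : V.ρ z = c • LinearMap.id := congr(($hc).hom.hom.hom).symm
  have hmul (g : G) : V.character (z * g) = c * V.character g := by
    rw [FDRep.character, map_mul, hρ]
    exact map_smul (LinearMap.trace ℂ V) c (V.ρ g)
  have hpow (n : ℕ) : V.character (z ^ n) = c ^ n * V.character 1 := by
    induction n with
    | zero => simp
    | succ n ih => rw [pow_succ', hmul, ih, pow_succ', mul_assoc]
  refine ⟨c, mul_right_cancel₀ h1 ?_, hmul⟩
  rw [← hpow, pow_card_eq_one, one_mul]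

theorem exists_norm_lt {g : G} (hg : g ∉ Subgroup.center G) :
    ∃ ψ, IsIrrChar G ψ ∧ ‖ψ g‖ < ‖ψ 1‖ := by
  obtain ⟨V, _, _, _, ρ, hρ, h⟩ := exists_isIrreducible_ne_smul_id hg
  refine ⟨ρ.character, isIrrChar_of_isIrreducible ρ, lt_of_not_ge fun hle => ?_⟩
  rw [Representation.char_one, Complex.norm_natCast] at hle
  obtain ⟨c, hc⟩ := eq_smul_id_of_finrank_le_norm_trace Fintype.card_ne_zero
    (by rw [← map_pow, pow_card_eq_one, map_one]) hle
  exact h c hc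

end IsIrrChar

/-- If `χ` occurs in `p`, a central element scales both by the same factor. -/
theorem eq_of_charMult_ne_zero {G : Type} [Group G] [Fintype G] {p χ : G → ℂ} {z : G} {c d : ℂ}
    (hp : ∀ g, p (z * g) = c * p g) (hχ : ∀ g, χ (z * g) = d * χ g) (hd : ‖d‖ = 1)
    (h : charMult G p χ ≠ 0) : c = d := by
  have hs := right_ne_zero_of_mul h
  have hcd : (c * starRingEnd ℂ d) * ∑ g, p g * starRingEnd ℂ (χ g) =
      ∑ g, p g * starRingEnd ℂ (χ g) := by
    rw [Finset.mul_sum]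
    refine Eq.trans ?_ (Equiv.sum_comp (Equiv.mulLeft z) fun g => p g * starRingEnd ℂ (χ g))
    refine Finset.sum_congr rfl fun g _ => ?_
    rw [Equiv.coe_mulLeft, hp, hχ, map_mul]
    ring
  have h1 := mul_right_cancel₀ hs (hcd.trans (one_mul _).symm)
  have h2 : d * starRingEnd ℂ d = 1 := by rw [Complex.mul_conj']; simp [hd]
  exact mul_right_cancel₀ (right_ne_zero_of_mul_eq_one h2) (h1.trans h2.symm)

/-- Some product of irreducible characters is constant on the center and strictly smaller in norm
outside of it. -/
theorem exists_mem_closure_isIrrChar_norm_lt {G : Type} [Group G] [Fintype G] :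
    ∃ p ∈ Submonoid.closure {ψ : G → ℂ | IsIrrChar G ψ}, p 1 ≠ 0 ∧ (∀ z ∈ Subgroup.center G, p z = p 1) ∧
      ∀ g ∉ Subgroup.center G, ‖p g‖ < ‖p 1‖ := by
  classical
  choose! ψ hψ hlt using fun (g : G) (hg : g ∉ Subgroup.center G) => IsIrrChar.exists_norm_lt hg
  let s : Finset G := {g | g ∉ Subgroup.center G}
  have hs {g} : g ∈ s ↔ g ∉ Subgroup.center G := by simp [s]
  have h1 : ∀ g ∈ s, ψ g 1 ≠ 0 := fun g hg => (hψ g (hs.1 hg)).one_ne_zero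
  have hmem : ∀ g ∈ s, ψ g ∈ {ψ : G → ℂ | IsIrrChar G ψ} := fun g hg => hψ g (hs.1 hg)
  refine ⟨(∏ g ∈ s, ψ g) ^ Fintype.card G,
    pow_mem (prod_mem fun g hg => Submonoid.mem_closure_of_mem (hmem g hg)) _, ?_, ?_, ?_⟩
  · simpa [Finset.prod_eq_zero_iff] using fun g hg => h1 g hg
  · intro z hz
    simp only [Pi.pow_apply, Finset.prod_apply, ← Finset.prod_pow]
    refine Finset.prod_congr rfl fun g hg => ?_
    obtain ⟨c, hc, hmul⟩ := (hψ g (hs.1 hg)).exists_mul_eq hz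
    rw [← mul_one z, hmul, mul_pow, hc, one_mul]
  · intro g hg
    simp only [Pi.pow_apply, Finset.prod_apply, norm_pow, norm_prod]
    refine pow_lt_pow_left₀ ?_ (Finset.prod_nonneg fun _ _ => norm_nonneg _) Fintype.card_ne_zero
    rw [← Finset.mul_prod_erase s _ (hs.2 hg), ← Finset.mul_prod_erase s _ (hs.2 hg)]
    refine mul_lt_mul_of_lt_of_le_of_nonneg_of_pos (hlt g hg) ?_ (norm_nonneg _) ?_
    · exact Finset.prod_le_prod (fun _ _ => norm_nonneg _) fun k hk =>
        (hψ k (hs.1 (Finset.mem_of_mem_erase hk))).norm_le g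
    · exact Finset.prod_pos fun k hk => norm_pos_iff.2 (h1 k (Finset.mem_of_mem_erase hk))

theorem eventually_charMult_ne_zero {G : Type} [Group G] [Fintype G] {p χ η : G → ℂ}
    (hp1 : p 1 ≠ 0) (hpz : ∀ z ∈ Subgroup.center G, p z = p 1)
    (hpg : ∀ g ∉ Subgroup.center G, ‖p g‖ < ‖p 1‖)
    (hχ : IsIrrChar G χ) (hη : IsIrrChar G η)
    (h : ∀ z ∈ Subgroup.center G, χ z * η 1 = η z * χ 1) :
    ∀ᶠ n : ℕ in Filter.atTop, charMult G (fun g => χ g * (p ^ n) g) η ≠ 0 := by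
  classical
  have hlim := tendsto_sum_mul_pow (fun g => p g / p 1) (fun g => χ g * starRingEnd ℂ (η g)) fun g => by
    by_cases hg : g ∈ Subgroup.center G
    · left; rw [hpz g hg, div_self hp1]
    · right; rw [norm_div, div_lt_one (norm_pos_iff.2 hp1)]; exact hpg g hg
  have hterm (g : G) : χ g * starRingEnd ℂ (η g) * (if p g / p 1 = 1 then 1 else 0) =
      if g ∈ Subgroup.center G then χ 1 * starRingEnd ℂ (η 1) else 0 := by
    by_cases hg : g ∈ Subgroup.center G
    · rw [if_pos hg, hpz g hg, div_self hp1, if_pos rfl, mul_one]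
      obtain ⟨c, hc, hmul⟩ := hη.exists_mul_eq hg
      have hηg : η g = c * η 1 := by simpa using hmul 1
      have hχg : χ g = c * χ 1 := mul_right_cancel₀ hη.one_ne_zero (by rw [h g hg, hηg]; ring)
      have h2 : c * starRingEnd ℂ c = 1 := by
        rw [Complex.mul_conj', Complex.norm_eq_one_of_pow_eq_one hc Fintype.card_ne_zero]; simp
      rw [hηg, hχg, map_mul]
      linear_combination (χ 1 * starRingEnd ℂ (η 1)) * h2
    · have : p g / p 1 ≠ 1 := fun h1 => (hpg g hg).ne (by rw [(div_eq_one_iff_eq hp1).1 h1])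
      rw [if_neg hg, if_neg this, mul_zero]
  simp only [hterm] at hlim
  have hne : ∑ g : G, (if g ∈ Subgroup.center G then χ 1 * starRingEnd ℂ (η 1) else 0) ≠ 0 := by
    rw [← Finset.sum_filter, Finset.sum_const, nsmul_eq_mul]
    refine mul_ne_zero (Nat.cast_ne_zero.2 (Finset.card_ne_zero.2 ⟨1, ?_⟩))
      (mul_ne_zero hχ.one_ne_zero ((map_ne_zero _).2 hη.one_ne_zero))
    simp [one_mem]
  filter_upwards [hlim.eventually_ne hne] with n hn
  refine mul_ne_zero (inv_ne_zero (Nat.cast_ne_zero.2 Fintype.card_ne_zero)) fun h0 => hn ?_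
  have : ∑ g, χ g * starRingEnd ℂ (η g) * (p g / p 1) ^ n =
      (p 1 ^ n)⁻¹ * ∑ g, χ g * (p ^ n) g * starRingEnd ℂ (η g) := by
    rw [Finset.mul_sum]
    refine Finset.sum_congr rfl fun g _ => ?_
    rw [Pi.pow_apply, div_pow]
    ring
  rw [this, h0, mul_zero]

/-- Two irreducible characters of a finite group are chain-equivalent if and only if
they have the same central character (Müger's theorem: the chain group `𝓒(G)` is
isomorphic to the dual of the center `Z(G)`). -/
theorem chainEquiv_iff_same_central_character (G : Type) [Group G] [Fintype G]
    (χ η : G → ℂ) (hχ : IsIrrChar G χ) (hη : IsIrrChar G η) :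
    ChainEquiv G χ η ↔
      ∀ z ∈ Subgroup.center G, χ z * η 1 = η z * χ 1 := by
  constructor
  · rintro ⟨n, ψ, hψ, h1, h2⟩ z hz
    choose c hc hmul using fun i => (hψ i).exists_mul_eq hz
    obtain ⟨d, hd, hχz⟩ := hχ.exists_mul_eq hz
    obtain ⟨e, he, hηz⟩ := hη.exists_mul_eq hz
    have hp (g : G) : ∏ i, ψ i (z * g) = (∏ i, c i) * ∏ i, ψ i g := by
      simp_rw [hmul, Finset.prod_mul_distrib]
    have hcd := eq_of_charMult_ne_zero hp hχz
      (Complex.norm_eq_one_of_pow_eq_one hd Fintype.card_ne_zero) h1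
    have hce := eq_of_charMult_ne_zero hp hηz
      (Complex.norm_eq_one_of_pow_eq_one he Fintype.card_ne_zero) h2
    rw [← mul_one z, hχz, hηz, ← hcd, ← hce]
    ring
  · intro h
    obtain ⟨p, hp, hp1, hpz, hpg⟩ := exists_mem_closure_isIrrChar_norm_lt (G := G)
    obtain ⟨n, hn1, hn2⟩ := ((eventually_charMult_ne_zero hp1 hpz hpg hχ hχ fun _ _ => rfl).and
      (eventually_charMult_ne_zero hp1 hpz hpg hχ hη h)).exists
    obtain ⟨k, ψ, hψ, hprod⟩ := exists_prod_eq_mul_of_mem_closure hχ (pow_mem hp n)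
    exact ⟨k, ψ, hψ, by simpa only [hprod] using hn1, by simpa only [hprod] using hn2⟩
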